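/- Fix probability vectors p = (p_w, p_d, p_ℓ) and q = (q_w, q_d, q_ℓ). If the defensive style is fair but non-safe, i.e. q_w = q_ℓ > 0, and Off is strictly losing, i.e. 0 ≤ p_w < p_ℓ, then the gain of the catenaccio policy converges as the horizon N tends to infinity: g_N^(cat) → p_w/p_ℓ − 1, and this limit is strictly negative. -/

import Mathlib

noncomputable section

open Filter Topology Finset

/-- The sign of an integer score, as a real number (`sgn 0 = 0`). -/
def sgn (x : ℤ) : ℝ := if 0 < x then 1 else if x < 0 then -1 else 0

/-- Expected sign of the score after one more game played with win/draw/loss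
probabilities `w, d, l`, starting from score `x`. -/
def stepVal (w d l : ℝ) (x : ℤ) : ℝ := w * sgn (x + 1) + d * sgn x + l * sgn (x - 1)

/-- Bellman value function with `k` games remaining: `bellman p q k x = V_{N-k}^N(x)`.
With no game remaining the value is the sign of the score; otherwise Player 1 picks the
better of the offensive style `(pw, pd, pl)` and the defensive style `(qw, qd, ql)`. -/
def bellman (pw pd pl qw qd ql : ℝ) : ℕ → ℤ → ℝ
  | 0, x => sgn x
  | k + 1, x =>
      max
        (pw * bellman pw pd pl qw qd ql k (x + 1) + pd * bellman pw pd pl qw qd ql k x +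
          pl * bellman pw pd pl qw qd ql k (x - 1))
        (qw * bellman pw pd pl qw qd ql k (x + 1) + qd * bellman pw pd pl qw qd ql k x +
          ql * bellman pw pd pl qw qd ql k (x - 1))

/-- Optimal gain over `N` games: `g*_N = V_0^N(0)`. -/
def gOpt (pw pd pl qw qd ql : ℝ) (N : ℕ) : ℝ := bellman pw pd pl qw qd ql N 0

/-- The two playing styles of Player 1. -/
inductive Style
  | offense
  | defense
deriving DecidableEq

/-- Selects the probability attached to a style: `a` for offense, `b` for defense. -/
def styleP (a b : ℝ) : Style → ℝ
  | .offense => a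
  | .defense => b

/-- Probability mass function of the score process `X_n` under the policy `π`
(playing `π n x` at round `n+1` when the current score is `x`), started at `X_0 = 0`. -/
def polDist (pw pd pl qw qd ql : ℝ) (π : ℕ → ℤ → Style) : ℕ → ℤ → ℝ
  | 0, x => if x = 0 then 1 else 0
  | n + 1, x =>
      polDist pw pd pl qw qd ql π n (x - 1) * styleP pw qw (π n (x - 1)) +
      polDist pw pd pl qw qd ql π n x * styleP pd qd (π n x) +
      polDist pw pd pl qw qd ql π n (x + 1) * styleP pl ql (π n (x + 1))

/-- Gain of policy `π` over `n` games: `g_n^π = E[sign (X_n)]`. -/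
def gPol (pw pd pl qw qd ql : ℝ) (π : ℕ → ℤ → Style) (n : ℕ) : ℝ :=
  ∑' x : ℤ, polDist pw pd pl qw qd ql π n x * sgn x

/-- Probability mass function of the pair (score, switched-to-defense flag) under the
catenaccio policy: play offense until the score first reaches `+1`, then defense forever. -/
def catDist (pw pd pl qw qd ql : ℝ) : ℕ → ℤ → Bool → ℝ
  | 0, x, b => if x = 0 ∧ b = false then 1 else 0
  | n + 1, x, true =>
      catDist pw pd pl qw qd ql n (x - 1) true * qw +
      catDist pw pd pl qw qd ql n x true * qd +
      catDist pw pd pl qw qd ql n (x + 1) true * ql +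
      (if x = 1 then
        catDist pw pd pl qw qd ql n 0 false * pw +
        catDist pw pd pl qw qd ql n 1 false * pd +
        catDist pw pd pl qw qd ql n 2 false * pl
       else 0)
  | n + 1, x, false =>
      if x = 1 then 0
      else
        catDist pw pd pl qw qd ql n (x - 1) false * pw +
        catDist pw pd pl qw qd ql n x false * pd +
        catDist pw pd pl qw qd ql n (x + 1) false * pl

/-- Gain of the catenaccio policy over `N` games: `g_N^(cat) = E[sign (X_N)]`. -/
def gCat (pw pd pl qw qd ql : ℝ) (N : ℕ) : ℝ :=
  ∑' x : ℤ,
    (catDist pw pd pl qw qd ql N x false + catDist pw pd pl qw qd ql N x true) * sgn x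

/-- Gain of the catenaccio+ policy over `N` games: play catenaccio, except that if the
score after `N - 1` games is `0`, the last game is played with the better of the two
styles (offense if `pw - pl > qw - ql`, defense otherwise). -/
def gCatPlus (pw pd pl qw qd ql : ℝ) : ℕ → ℝ
  | 0 => 0
  | N + 1 =>
      ∑' x : ℤ,
        (catDist pw pd pl qw qd ql N x false *
            (if x = 0 then (if pw - pl > qw - ql then pw - pl else qw - ql)
             else stepVal pw pd pl x) +
          catDist pw pd pl qw qd ql N x true *
            (if x = 0 then (if pw - pl > qw - ql then pw - pl else qw - ql)
             else stepVal qw qd ql x))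

/-- Probability mass function of the lazy random walk with i.i.d. increments (+1 with
probability `qw`, 0 with probability `qd`, −1 with probability `ql`), started at `0`. -/
def walkDist (qw qd ql : ℝ) : ℕ → ℤ → ℝ
  | 0, x => if x = 0 then 1 else 0
  | n + 1, x =>
      walkDist qw qd ql n (x - 1) * qw + walkDist qw qd ql n x * qd +
        walkDist qw qd ql n (x + 1) * ql

/-- Fixed-style gain over `N` games for the walk with step law `(qw, qd, ql)`. -/
def gFixed (qw qd ql : ℝ) (N : ℕ) : ℝ := ∑' x : ℤ, walkDist qw qd ql N x * sgn x

/-- Probability mass function of the lazy random walk with step law `(pw, pd, pl)`,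
started at `0` and absorbed (stopped) at the level `+1`.  In particular
`stoppedDist pw pd pl n 1` is the probability that the walk reaches `+1` by time `n`. -/
def stoppedDist (pw pd pl : ℝ) : ℕ → ℤ → ℝ
  | 0, x => if x = 0 then 1 else 0
  | n + 1, x =>
      if x = 1 then
        stoppedDist pw pd pl n 1 + stoppedDist pw pd pl n 0 * pw +
          stoppedDist pw pd pl n 2 * pl
      else
        (if x - 1 = 1 then 0 else stoppedDist pw pd pl n (x - 1) * pw) +
          stoppedDist pw pd pl n x * pd +
          (if x + 1 = 1 then 0 else stoppedDist pw pd pl n (x + 1) * pl)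
/-- Expected sign of the score after `n` defensive games, starting from score `x`. -/
def defVal (qw qd ql : ℝ) : ℕ → ℤ → ℝ
  | 0, x => sgn x
  | n + 1, x =>
      qw * defVal qw qd ql n (x + 1) + qd * defVal qw qd ql n x + ql * defVal qw qd ql n (x - 1)

/-- Expected sign of the score after `n` further games of catenaccio, starting from score `x`
before the switch to defense. -/
def offVal (pw pd pl qw qd ql : ℝ) : ℕ → ℤ → ℝ
  | 0, x => sgn x
  | n + 1, x =>
      pw * (if x + 1 = 1 then defVal qw qd ql n (x + 1)
        else offVal pw pd pl qw qd ql n (x + 1)) +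
      pd * (if x = 1 then defVal qw qd ql n x else offVal pw pd pl qw qd ql n x) +
      pl * (if x - 1 = 1 then defVal qw qd ql n (x - 1)
        else offVal pw pd pl qw qd ql n (x - 1))

lemma summable_mul_of_finite_support {f : ℤ → ℝ} (hf : f.support.Finite) (g : ℤ → ℝ) :
    Summable fun x => f x * g x :=
  summable_of_hasFiniteSupport (hf.subset (Function.support_mul_subset_left f g))

lemma finite_support_comp_add {f : ℤ → ℝ} (hf : f.support.Finite) (c : ℤ) :
    (fun x => f (x + c)).support.Finite :=
  hf.preimage (f := fun x : ℤ => x + c) (add_left_injective c).injOn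

lemma finite_support_comp_sub {f : ℤ → ℝ} (hf : f.support.Finite) (c : ℤ) :
    (fun x => f (x - c)).support.Finite := by
  simpa only [sub_eq_add_neg] using finite_support_comp_add hf (-c)

lemma finite_support_step {f : ℤ → ℝ} (hf : f.support.Finite) (a b c : ℝ) :
    (fun x => f (x - 1) * a + f x * b + f (x + 1) * c).support.Finite := by
  refine (((finite_support_comp_sub hf 1).union hf).union
    (finite_support_comp_add hf 1)).subset fun x hx => ?_
  by_contra h
  simp only [Set.mem_union, Function.mem_support, not_or, not_not] at h
  simp [h] at hx

/-- One forward step of a walk is dual to one backward step. -/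
lemma tsum_step_mul {f : ℤ → ℝ} (hf : f.support.Finite) (g : ℤ → ℝ) (a b c : ℝ) :
    ∑' x, (f (x - 1) * a + f x * b + f (x + 1) * c) * g x =
      ∑' x, f x * (a * g (x + 1) + b * g x + c * g (x - 1)) := by
  have h₁ : ∑' x, f (x - 1) * (a * g x) = ∑' x, f x * (a * g (x + 1)) := by
    rw [← (Equiv.addRight (1 : ℤ)).tsum_eq]
    simp
  have h₂ : ∑' x, f (x + 1) * (c * g x) = ∑' x, f x * (c * g (x - 1)) := by
    rw [← (Equiv.subRight (1 : ℤ)).tsum_eq]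
    simp
  have s₁ := summable_mul_of_finite_support (finite_support_comp_sub hf 1) fun x => a * g x
  have s₂ := summable_mul_of_finite_support hf fun x => b * g x
  have s₃ := summable_mul_of_finite_support (finite_support_comp_add hf 1) fun x => c * g x
  have s₁' := summable_mul_of_finite_support hf fun x => a * g (x + 1)
  have s₃' := summable_mul_of_finite_support hf fun x => c * g (x - 1)
  simp only [mul_add, add_mul, mul_assoc]
  rw [(s₁.add s₂).tsum_add s₃, s₁.tsum_add s₂, (s₁'.add s₂).tsum_add s₃', s₁'.tsum_add s₂, h₁, h₂]

lemma catDist_finite_support (pw pd pl qw qd ql : ℝ) (n : ℕ) (b : Bool) :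
    (fun x => catDist pw pd pl qw qd ql n x b).support.Finite := by
  induction n generalizing b with
  | zero =>
    refine (Set.finite_singleton (0 : ℤ)).subset fun x hx => ?_
    by_contra h
    simp_all [catDist]
  | succ n ih =>
    have hs (b : Bool) := ((finite_support_comp_sub (ih b) 1).union (ih b)).union
      (finite_support_comp_add (ih b) 1)
    refine (((hs true).union (hs false)).union (Set.finite_singleton (1 : ℤ))).subset fun x hx => ?_
    by_contra h
    simp only [Set.mem_union, Function.mem_support, Set.mem_singleton_iff, not_or, not_not] at h
    cases b <;> simp_all [catDist]

lemma tsum_catDist_mul_val (pw pd pl qw qd ql : ℝ) (m n : ℕ) :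
    ∑' x, (catDist pw pd pl qw qd ql m x false * offVal pw pd pl qw qd ql n x +
      catDist pw pd pl qw qd ql m x true * defVal qw qd ql n x) =
      offVal pw pd pl qw qd ql (m + n) 0 := by
  induction m generalizing n with
  | zero =>
    rw [tsum_eq_single 0 (by intro x hx; simp [catDist, hx])]
    simp [catDist]
  | succ m ih =>
    have hf := catDist_finite_support pw pd pl qw qd ql m
    rw [show m + 1 + n = m + (n + 1) by ring, ← ih]
    have hT := summable_mul_of_finite_support (hf true) (defVal qw qd ql (n + 1))
    have hF := summable_mul_of_finite_support (hf false) (offVal pw pd pl qw qd ql (n + 1))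
    rw [hF.tsum_add hT]
    simp only [offVal, defVal]
    rw [← tsum_step_mul (hf true) (defVal qw qd ql n),
      ← tsum_step_mul (hf false)
        (fun x => if x = 1 then defVal qw qd ql n x else offVal pw pd pl qw qd ql n x),
      ← Summable.tsum_add]
    · refine tsum_congr fun x => ?_
      by_cases hx : x = 1
      · subst hx
        simp [catDist]
        ring
      · simp [catDist, hx]
    · exact summable_mul_of_finite_support (finite_support_step (hf false) pw pd pl) _
    · exact summable_mul_of_finite_support (finite_support_step (hf true) qw qd ql) _

lemma gCat_eq_offVal (pw pd pl qw qd ql : ℝ) (N : ℕ) :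
    gCat pw pd pl qw qd ql N = offVal pw pd pl qw qd ql N 0 := by
  rw [← add_zero N, ← tsum_catDist_mul_val]
  simp only [gCat, offVal, defVal, add_mul, add_zero]

section FairWalk

variable {q d : ℝ}

lemma defVal_neg (n : ℕ) (x : ℤ) : defVal q d q n (-x) = -defVal q d q n x := by
  induction n generalizing x with
  | zero =>
    simp only [defVal, sgn]
    split_ifs <;> first | omega | norm_num
  | succ n ih =>
    have h₁ := ih (x - 1)
    have h₂ := ih (x + 1)
    rw [show -(x - 1) = -x + 1 by ring] at h₁
    rw [show -(x + 1) = -x - 1 by ring] at h₂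
    simp only [defVal, h₁, h₂, ih x]
    ring

lemma defVal_zero_right (n : ℕ) : defVal q d q n 0 = 0 := by
  have h := defVal_neg (q := q) (d := d) n 0
  rw [neg_zero] at h
  linarith

lemma defVal_nonneg (hq : 0 ≤ q) (hd : 0 ≤ d) (n : ℕ) {x : ℤ} (hx : 0 ≤ x) :
    0 ≤ defVal q d q n x := by
  induction n generalizing x with
  | zero =>
    simp only [defVal, sgn]
    split_ifs <;> first | omega | norm_num
  | succ n ih =>
    rcases hx.eq_or_lt with rfl | hx
    · exact (defVal_zero_right _).ge
    have h₁ := ih (x := x + 1) (by omega)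
    have h₂ := ih hx.le
    have h₃ := ih (x := x - 1) (by omega)
    simp only [defVal]
    positivity

lemma defVal_succ_le (hq : 0 ≤ q) (hd : 0 ≤ d) (hsum : q + d + q = 1) (n : ℕ) {x : ℤ}
    (hx : 0 ≤ x) : defVal q d q (n + 1) x ≤ defVal q d q n x := by
  induction n generalizing x with
  | zero =>
    rcases hx.eq_or_lt with rfl | hx
    · rw [defVal_zero_right, defVal_zero_right]
    simp only [defVal, sgn]
    split_ifs <;> first | omega | linarith
  | succ n ih =>
    rcases hx.eq_or_lt with rfl | hx
    · rw [defVal_zero_right, defVal_zero_right]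
    have h₁ := ih (x := x + 1) (by omega)
    have h₂ := ih hx.le
    have h₃ := ih (x := x - 1) (by omega)
    rw [defVal]
    conv_rhs => rw [defVal]
    gcongr

lemma tendsto_defVal_one (hq : 0 < q) (hd : 0 ≤ d) (hsum : q + d + q = 1) :
    Tendsto (fun n => defVal q d q n 1) atTop (𝓝 0) := by
  have anti (k : ℕ) : Antitone fun n => defVal q d q n k :=
    antitone_nat_of_succ_le fun n => defVal_succ_le hq.le hd hsum n (by positivity)
  have bdd (k : ℕ) : BddBelow (Set.range fun n => defVal q d q n k) :=
    ⟨0, by rintro _ ⟨n, rfl⟩; exact defVal_nonneg hq.le hd n (by positivity)⟩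
  obtain ⟨L, hL⟩ : ∃ L : ℕ → ℝ, ∀ k : ℕ, Tendsto (fun n => defVal q d q n k) atTop (𝓝 (L k)) :=
    ⟨_, fun k => tendsto_atTop_ciInf (anti k) (bdd k)⟩
  have hL0 : L 0 = 0 := by
    refine tendsto_nhds_unique (hL 0) ?_
    simp [defVal_zero_right]
  have hstep (k : ℕ) : L (k + 2) = 2 * L (k + 1) - L k := by
    have h := (((hL (k + 2)).const_mul q).add ((hL (k + 1)).const_mul d)).add
      ((hL k).const_mul q)
    have h' := (hL (k + 1)).comp (tendsto_add_atTop_nat 1)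
    have heq : L (k + 1) = q * L (k + 2) + d * L (k + 1) + q * L k := by
      refine tendsto_nhds_unique h' (h.congr fun n => ?_)
      simp only [Function.comp, defVal]
      push_cast
      ring_nf
    refine mul_left_cancel₀ hq.ne' ?_
    linear_combination (-1) * heq - L (k + 1) * hsum
  have hlin (k : ℕ) : L k = k * L 1 ∧ L (k + 1) = (k + 1) * L 1 := by
    induction k with
    | zero => simp [hL0]
    | succ k ih =>
      refine ⟨by simpa using ih.2, ?_⟩
      rw [hstep, ih.1, ih.2]
      push_cast
      ring
  have hnonneg : 0 ≤ L 1 :=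
    ge_of_tendsto' (hL 1) fun n => defVal_nonneg hq.le hd n (by positivity)
  have hle (k : ℕ) : L k ≤ 1 := by
    refine ((anti k).le_of_tendsto (hL k) 0).trans ?_
    simp only [defVal, sgn]
    split_ifs <;> norm_num
  have hL1 : L 1 = 0 := by
    by_contra h
    obtain ⟨k, hk⟩ := exists_nat_gt (1 / L 1)
    have h₁ := hle k
    rw [(hlin k).1] at h₁
    rw [div_lt_iff₀ (lt_of_le_of_ne hnonneg (Ne.symm h))] at hk
    linarith
  simpa [hL1] using hL 1

end FairWalk

/-- The solution of `b (n + 1) = c * b n + w n` with `b 0 = 1`. -/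
def linRec (c : ℝ) (w : ℕ → ℝ) : ℕ → ℝ
  | 0 => 1
  | n + 1 => c * linRec c w n + w n

lemma linRec_nonneg {c : ℝ} {w : ℕ → ℝ} (hc : 0 ≤ c) (hw : ∀ n, 0 ≤ w n) (n : ℕ) :
    0 ≤ linRec c w n := by
  induction n with
  | zero => exact zero_le_one
  | succ n ih => exact add_nonneg (mul_nonneg hc ih) (hw n)

lemma tendsto_linRec {c : ℝ} {w : ℕ → ℝ} (hc : 0 ≤ c) (hc1 : c < 1) (hw : ∀ n, 0 ≤ w n)
    (hlim : Tendsto w atTop (𝓝 0)) : Tendsto (linRec c w) atTop (𝓝 0) := by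
  have hb := linRec_nonneg hc hw
  rw [Metric.tendsto_atTop]
  intro ε hε
  have hδ : 0 < (1 - c) * (ε / 2) := mul_pos (by linarith) (by linarith)
  obtain ⟨m, hm⟩ := eventually_atTop.1 (hlim.eventually (gt_mem_nhds hδ))
  have key (n : ℕ) : linRec c w (m + n) ≤ ε / 2 + c ^ n * linRec c w m := by
    induction n with
    | zero => simp; linarith
    | succ n ih =>
      have h₁ := hm (m + n) (by omega)
      have h₂ := mul_le_mul_of_nonneg_left ih hc
      rw [← add_assoc, linRec, pow_succ]
      linarith
  have hpow : Tendsto (fun n => c ^ n * linRec c w m) atTop (𝓝 0) := by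
    simpa using (tendsto_pow_atTop_nhds_zero_of_lt_one hc hc1).mul_const (linRec c w m)
  obtain ⟨k, hk⟩ := eventually_atTop.1 (hpow.eventually (gt_mem_nhds (half_pos hε)))
  refine ⟨m + k, fun n hn => ?_⟩
  obtain ⟨j, rfl⟩ := Nat.exists_eq_add_of_le (show m ≤ n by omega)
  rw [Real.dist_0_eq_abs, abs_of_nonneg (hb _)]
  linarith [key j, hk j (by omega)]

lemma abs_offVal_sub_le {pw pd pl q d r s : ℝ} (hpw : 0 ≤ pw) (hpd : 0 ≤ pd) (hpl : 0 ≤ pl)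
    (hp : pw + pd + pl = 1) (hq : 0 ≤ q) (hd : 0 ≤ d) (hr : pl * r = pw) (hr0 : 0 ≤ r)
    (hrs : r < s) (hs1 : s < 1) (n k : ℕ) :
    |offVal pw pd pl q d q n (-k) - (r ^ (k + 1) - 1)| ≤
      linRec (pw / s + pd + pl * s) (fun n => defVal q d q n 1) n * s ^ k := by
  have hs : 0 < s := hr0.trans_lt hrs
  set c := pw / s + pd + pl * s with hc
  have hcs : c * s = pw + pd * s + pl * s * s := by
    rw [hc]
    field_simp
  have hw (n : ℕ) : 0 ≤ defVal q d q n 1 := defVal_nonneg hq hd n zero_le_one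
  have hb := linRec_nonneg (c := c) (by positivity) hw
  induction n generalizing k with
  | zero =>
    rcases k with _ | k
    · simp only [offVal, linRec, sgn]
      norm_num
      rw [abs_le]
      constructor <;> linarith
    · have h₁ : sgn (-((k + 1 : ℕ) : ℤ)) = -1 := by
        rw [sgn, if_neg (by omega), if_pos (by omega)]
      simp only [offVal, linRec, h₁]
      rw [show -1 - (r ^ (k + 1 + 1) - 1) = -(r ^ (k + 1 + 1)) by ring, abs_neg,
        abs_of_nonneg (by positivity), one_mul]
      calc r ^ (k + 1 + 1) ≤ r ^ (k + 1) :=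
            pow_le_pow_of_le_one hr0 (by linarith) (by omega)
        _ ≤ s ^ (k + 1) := by gcongr
  | succ n ih =>
    have hwn := hw n
    have hbn := hb n
    rcases k with _ | k
    · have h₀ := abs_le.1 (ih 0)
      have h₁ := abs_le.1 (ih 1)
      simp only [offVal, linRec]
      norm_num at h₀ h₁ ⊢
      set v := defVal q d q n 1
      set b := linRec c (fun n => defVal q d q n 1) n
      set A := offVal pw pd pl q d q n 0
      set B := offVal pw pd pl q d q n (-1)
      have e : pw * v + pd * A + pl * B - (r - 1) =
          pw * v + pd * (A - (r - 1)) + pl * (B - (r ^ 2 - 1)) := by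
        linear_combination (r - 1) * hp + (r - 1) * hr
      have hcb : (pd + pl * s) * b ≤ c * b := by
        refine mul_le_mul_of_nonneg_right ?_ hbn
        have : 0 ≤ pw / s := by positivity
        linarith
      have hv : pw * v ≤ v := mul_le_of_le_one_left hwn (by linarith)
      have hv0 : 0 ≤ pw * v := by positivity
      have hA := mul_le_mul_of_nonneg_left h₀.1 hpd
      have hA' := mul_le_mul_of_nonneg_left h₀.2 hpd
      have hB := mul_le_mul_of_nonneg_left h₁.1 hpl
      have hB' := mul_le_mul_of_nonneg_left h₁.2 hpl
      rw [e, abs_le]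
      constructor <;> nlinarith
    · have h₀ := abs_le.1 (ih k)
      have h₁ := abs_le.1 (ih (k + 1))
      have h₂ := abs_le.1 (ih (k + 2))
      have e₀ : -((k + 1 : ℕ) : ℤ) + 1 = -(k : ℤ) := by push_cast; ring
      have e₂ : -((k + 1 : ℕ) : ℤ) - 1 = -((k + 2 : ℕ) : ℤ) := by push_cast; ring
      simp only [offVal, linRec, e₀, e₂]
      rw [if_neg (by omega), if_neg (by omega), if_neg (by omega)]
      set v := defVal q d q n 1
      set b := linRec c (fun n => defVal q d q n 1) n
      set A := offVal pw pd pl q d q n (-(k : ℤ))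
      set B := offVal pw pd pl q d q n (-((k + 1 : ℕ) : ℤ))
      set C := offVal pw pd pl q d q n (-((k + 2 : ℕ) : ℤ))
      have e : pw * A + pd * B + pl * C - (r ^ (k + 1 + 1) - 1) =
          pw * (A - (r ^ (k + 1) - 1)) + pd * (B - (r ^ (k + 1 + 1) - 1)) +
            pl * (C - (r ^ (k + 2 + 1) - 1)) := by
        linear_combination (r ^ (k + 2) - 1) * hp + (r ^ (k + 2) - r ^ (k + 1)) * hr
      have hcb : c * b * s ^ (k + 1) =
          pw * (b * s ^ k) + pd * (b * s ^ (k + 1)) + pl * (b * s ^ (k + 2)) := by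
        linear_combination b * s ^ k * hcs
      have hv : 0 ≤ v * s ^ (k + 1) := by positivity
      have hA := mul_le_mul_of_nonneg_left h₀.1 hpw
      have hA' := mul_le_mul_of_nonneg_left h₀.2 hpw
      have hB := mul_le_mul_of_nonneg_left h₁.1 hpd
      have hB' := mul_le_mul_of_nonneg_left h₁.2 hpd
      have hC := mul_le_mul_of_nonneg_left h₂.1 hpl
      have hC' := mul_le_mul_of_nonneg_left h₂.2 hpl
      rw [e, add_mul, hcb, abs_le]
      constructor <;> linarith

/-- If the defensive style is fair but non-safe (`qw = ql > 0`) and the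
offensive style is strictly losing (`0 ≤ pw < pl`), then the gain of the catenaccio
policy converges to `pw / pl − 1 < 0` as `N → ∞`. -/
theorem catenaccio_gain_tendsto_of_fair_nonsafe_defense
    (pw pd pl qw qd ql : ℝ)
    (hpw : 0 ≤ pw) (hpd : 0 ≤ pd) (hpl : 0 ≤ pl) (hp : pw + pd + pl = 1)
    (hqw : 0 ≤ qw) (hqd : 0 ≤ qd) (hql : 0 ≤ ql) (hq : qw + qd + ql = 1)
    (hfair : qw = ql) (hq0 : 0 < ql) (hlose : pw < pl) :
    Tendsto (fun N : ℕ => gCat pw pd pl qw qd ql N) atTop (𝓝 (pw / pl - 1)) ∧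
      pw / pl - 1 < 0 := by
  subst hfair
  have hpl0 : 0 < pl := hpw.trans_lt hlose
  have hr1 : pw / pl < 1 := (div_lt_one hpl0).2 hlose
  have hr0 : 0 ≤ pw / pl := by positivity
  have hr : pl * (pw / pl) = pw := mul_div_cancel₀ pw hpl0.ne'
  refine ⟨?_, by linarith⟩
  obtain ⟨s, hrs, hs1⟩ := exists_between hr1
  have hs : 0 < s := hr0.trans_lt hrs
  have hc1 : pw / s + pd + pl * s < 1 := by
    have hps : pw < pl * s := by
      rw [div_lt_iff₀ hpl0] at hrs
      linarith
    have h : pw / s * s = pw := div_mul_cancel₀ pw hs.ne'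
    refine lt_of_mul_lt_mul_right ?_ hs.le
    nlinarith [mul_pos (sub_pos.2 hps) (sub_pos.2 hs1)]
  have hb := tendsto_linRec (c := pw / s + pd + pl * s) (by positivity) hc1
    (fun n => defVal_nonneg hqw hqd n zero_le_one) (tendsto_defVal_one hq0 hqd hq)
  simp only [gCat_eq_offVal]
  rw [tendsto_iff_dist_tendsto_zero]
  refine squeeze_zero (fun _ => dist_nonneg) (fun n => ?_) hb
  have h := abs_offVal_sub_le hpw hpd hpl hp hqw hqd hr hr0 hrs hs1 n 0
  rwa [Nat.cast_zero, neg_zero, zero_add, pow_one, pow_zero, mul_one, ← Real.dist_eq] at h
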